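/- arXiv:2204.10620 — 7 statements merged into one kernel-verified Lean document; each statement's English description precedes it below -/
import Mathlib

section
/- Let M > 0, L > 12M², and let 2M < s⁰_L < r⁰_L be the two zeros of (Ψ⁰_L)′ in (2M,∞). For every E with Ψ⁰_L(r⁰_L) < E < min{1, Ψ⁰_L(s⁰_L)}, the equation Ψ⁰_L(r) = E has exactly three solutions in (2M,∞), say r⁰₀ < r⁰₋ < r⁰₊, and these satisfy 2M < r⁰₀ < s⁰_L < r⁰₋ < r⁰_L < r⁰₊ as well as r⁰₋ > 4M. -/
open Real Filter Set Topology

/-- The Schwarzschild effective potential. -/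
noncomputable def Psi0 (M L r : ℝ) : ℝ :=
  Real.sqrt (1 - 2 * M / r) * Real.sqrt (1 + L / r ^ 2)

lemma one_sub_two_mul_div_pos {M x : ℝ} (hM : 0 < M) (hx : 2 * M < x) : 0 < 1 - 2 * M / x := by
  rw [sub_pos, div_lt_one (by linarith)]
  exact hx

lemma Psi0_nonneg (M L x : ℝ) : 0 ≤ Psi0 M L x := by
  unfold Psi0
  positivity

lemma Psi0_sq_mul_cube {M L x : ℝ} (hM : 0 < M) (hL : 0 ≤ L) (hx : 2 * M < x) :
    Psi0 M L x ^ 2 * x ^ 3 = (x - 2 * M) * (x ^ 2 + L) := by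
  have h0 : 0 < x := by linarith
  rw [Psi0, mul_pow, Real.sq_sqrt (one_sub_two_mul_div_pos hM hx).le, Real.sq_sqrt (by positivity)]
  field_simp

lemma Psi0_lt_iff {M L x E : ℝ} (hM : 0 < M) (hL : 0 ≤ L) (hx : 2 * M < x) (hE : 0 ≤ E) :
    Psi0 M L x < E ↔ (x - 2 * M) * (x ^ 2 + L) - E ^ 2 * x ^ 3 < 0 := by
  have h3 : 0 < x ^ 3 := pow_pos (by linarith) 3
  rw [← Psi0_sq_mul_cube hM hL hx, sub_neg, mul_lt_mul_iff_left₀ h3,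
    pow_lt_pow_iff_left₀ (Psi0_nonneg M L x) hE two_ne_zero]

lemma lt_Psi0_iff {M L x E : ℝ} (hM : 0 < M) (hL : 0 ≤ L) (hx : 2 * M < x) (hE : 0 ≤ E) :
    E < Psi0 M L x ↔ 0 < (x - 2 * M) * (x ^ 2 + L) - E ^ 2 * x ^ 3 := by
  have h3 : 0 < x ^ 3 := pow_pos (by linarith) 3
  rw [← Psi0_sq_mul_cube hM hL hx, sub_pos, mul_lt_mul_iff_left₀ h3,
    pow_lt_pow_iff_left₀ hE (Psi0_nonneg M L x) two_ne_zero]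

lemma Psi0_eq_iff {M L x E : ℝ} (hM : 0 < M) (hL : 0 ≤ L) (hx : 2 * M < x) (hE : 0 ≤ E) :
    Psi0 M L x = E ↔ (x - 2 * M) * (x ^ 2 + L) - E ^ 2 * x ^ 3 = 0 := by
  have h3 : x ^ 3 ≠ 0 := (pow_pos (by linarith) 3).ne'
  rw [← Psi0_sq_mul_cube hM hL hx, sub_eq_zero, mul_left_inj' h3,
    pow_left_inj₀ (Psi0_nonneg M L x) hE two_ne_zero]

lemma quadratic_of_deriv_Psi0_eq_zero {M L x : ℝ} (hM : 0 < M) (hL : 0 ≤ L) (hx : 2 * M < x)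
    (hd : deriv (Psi0 M L) x = 0) : M * x ^ 2 - L * x + 3 * M * L = 0 := by
  have h0 : 0 < x := by linarith
  have hA := one_sub_two_mul_div_pos hM hx
  have hB : 0 < 1 + L / x ^ 2 := by positivity
  have hdiff : DifferentiableAt ℝ (Psi0 M L) x := by
    unfold Psi0
    refine DifferentiableAt.mul (DifferentiableAt.sqrt ?_ hA.ne') (DifferentiableAt.sqrt ?_ hB.ne')
    · exact (differentiableAt_const _).sub ((differentiableAt_const _).div differentiableAt_id h0.ne')
    · exact (differentiableAt_const _).add
        ((differentiableAt_const _).div (differentiableAt_id.pow 2) (by positivity))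
  have hP : HasDerivAt (Psi0 M L) 0 x := hd ▸ hdiff.hasDerivAt
  have hl := (hP.pow 2).mul (hasDerivAt_pow 3 x)
  have hr := ((hasDerivAt_id x).sub_const (2 * M)).mul ((hasDerivAt_pow 2 x).add_const L)
  have heq : (Psi0 M L ^ 2 * fun y : ℝ => y ^ 3) =ᶠ[𝓝 x]
      ((fun y => id y - 2 * M) * fun y => y ^ 2 + L) := by
    filter_upwards [lt_mem_nhds hx] with y hy
    simpa using Psi0_sq_mul_cube hM hL hy
  have key := hl.unique (hr.congr_of_eventuallyEq heq)
  have hsq := Psi0_sq_mul_cube hM hL hx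
  simp only [Pi.pow_apply, id, Nat.cast_ofNat, mul_zero, zero_mul, zero_add, one_mul,
    Nat.add_one_sub_one, pow_one] at key
  linear_combination (3 / 2) * hsq - (1 / 2) * x * key

/-- A cubic with three distinct known roots has no others and factors accordingly. -/
lemma cubic_factor {a b c d u v w : ℝ} (huv : u < v) (hvw : v < w)
    (hu : a * u ^ 3 + b * u ^ 2 + c * u + d = 0) (hv : a * v ^ 3 + b * v ^ 2 + c * v + d = 0)
    (hw : a * w ^ 3 + b * w ^ 2 + c * w + d = 0) (x : ℝ) :
    a * x ^ 3 + b * x ^ 2 + c * x + d = a * ((x - u) * (x - v) * (x - w)) := by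
  have h1 : a * (u ^ 2 + u * v + v ^ 2) + b * (u + v) + c = 0 :=
    mul_left_cancel₀ (sub_ne_zero.2 huv.ne) (by linear_combination hu - hv)
  have h2 : a * (v ^ 2 + v * w + w ^ 2) + b * (v + w) + c = 0 :=
    mul_left_cancel₀ (sub_ne_zero.2 hvw.ne) (by linear_combination hv - hw)
  have h3 : a * (u + v + w) + b = 0 :=
    mul_left_cancel₀ (sub_ne_zero.2 (huv.trans hvw).ne) (by linear_combination h1 - h2)
  linear_combination hu + (x - u) * h1 + (x - u) * (x - v) * h3

theorem stmt_1 (M L : ℝ) (hM : 0 < M) (hL : 12 * M ^ 2 < L)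
    (s r : ℝ) (hs : 2 * M < s) (hsr : s < r)
    (hds : deriv (Psi0 M L) s = 0) (hdr : deriv (Psi0 M L) r = 0)
    (huniq : ∀ x : ℝ, 2 * M < x → deriv (Psi0 M L) x = 0 → x = s ∨ x = r)
    (hmax : IsLocalMax (Psi0 M L) s) (hmin : IsLocalMin (Psi0 M L) r)
    (E : ℝ) (hE1 : Psi0 M L r < E) (hE2 : E < min 1 (Psi0 M L s)) :
    ∃ r0 r1 r2 : ℝ,
      2 * M < r0 ∧ r0 < s ∧ s < r1 ∧ r1 < r ∧ r < r2 ∧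
      Psi0 M L r0 = E ∧ Psi0 M L r1 = E ∧ Psi0 M L r2 = E ∧
      4 * M < r1 ∧
      ∀ x : ℝ, 2 * M < x → Psi0 M L x = E → x = r0 ∨ x = r1 ∨ x = r2 := by
  have hL0 : 0 < L := by nlinarith [sq_nonneg M]
  have hr : 2 * M < r := hs.trans hsr
  have hE0 : 0 < E := (Psi0_nonneg M L r).trans_lt hE1
  obtain ⟨hE_one, hE_s⟩ := lt_min_iff.1 hE2
  have hEsq : 0 < 1 - E ^ 2 := by nlinarith
  have hqs := quadratic_of_deriv_Psi0_eq_zero hM hL0.le hs hds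
  have hqr := quadratic_of_deriv_Psi0_eq_zero hM hL0.le hr hdr
  have hsum : M * (s + r) = L :=
    mul_left_cancel₀ (sub_ne_zero.2 hsr.ne) (by linear_combination hqs - hqr)
  set P : ℝ → ℝ := fun x => (x - 2 * M) * (x ^ 2 + L) - E ^ 2 * x ^ 3 with hP
  have hcont : Continuous P := by fun_prop
  have hP0 : P (2 * M) < 0 := by
    have : 0 < E ^ 2 * (2 * M) ^ 3 := by positivity
    simp only [hP]
    linarith
  have hPs : 0 < P s := (lt_Psi0_iff hM hL0.le hs hE0.le).1 hE_s
  have hPr : P r < 0 := (Psi0_lt_iff hM hL0.le hr hE0.le).1 hE1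
  obtain ⟨R, hR, hPR⟩ : ∃ R, r < R ∧ 0 < P R := by
    refine ⟨r + 2 * M / (1 - E ^ 2), by linarith [div_pos (by positivity : 0 < 2 * M) hEsq], ?_⟩
    have hR := div_pos (by positivity : 0 < 2 * M) hEsq
    have hmul : (1 - E ^ 2) * (2 * M / (1 - E ^ 2)) = 2 * M := mul_div_cancel₀ _ hEsq.ne'
    set R := r + 2 * M / (1 - E ^ 2) with hR_def
    have h1 : 0 < (1 - E ^ 2) * R - 2 * M := by
      rw [hR_def, mul_add, hmul]
      have : 0 < (1 - E ^ 2) * r := mul_pos hEsq (by linarith)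
      linarith
    have h2 : 0 < R ^ 2 := pow_pos (by linarith) 2
    have h3 : 0 < L * (R - 2 * M) := mul_pos hL0 (by linarith)
    simp only [hP]
    linarith [mul_pos h2 h1]
  obtain ⟨r0, ⟨h0l, h0u⟩, h0⟩ :=
    intermediate_value_Ioo hs.le hcont.continuousOn (show (0 : ℝ) ∈ Ioo _ _ from ⟨hP0, hPs⟩)
  obtain ⟨r1, ⟨h1l, h1u⟩, h1⟩ :=
    intermediate_value_Ioo' hsr.le hcont.continuousOn (show (0 : ℝ) ∈ Ioo _ _ from ⟨hPr, hPs⟩)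
  obtain ⟨r2, ⟨h2l, h2u⟩, h2⟩ :=
    intermediate_value_Ioo hR.le hcont.continuousOn (show (0 : ℝ) ∈ Ioo _ _ from ⟨hPr, hPR⟩)
  have hfac : ∀ x, P x = (1 - E ^ 2) * ((x - r0) * (x - r1) * (x - r2)) := by
    intro x
    have hexp : ∀ y, P y = (1 - E ^ 2) * y ^ 3 + (-2 * M) * y ^ 2 + L * y + (-2 * M * L) := by
      intro y
      simp only [hP]
      ring
    rw [hexp] at h0 h1 h2 ⊢
    exact cubic_factor (h0u.trans h1l) (h1u.trans h2l) h0 h1 h2 x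
  refine ⟨r0, r1, r2, h0l, h0u, h1l, h1u, h2l,
    (Psi0_eq_iff hM hL0.le h0l hE0.le).2 h0,
    (Psi0_eq_iff hM hL0.le (hs.trans h1l) hE0.le).2 h1,
    (Psi0_eq_iff hM hL0.le (hr.trans h2l) hE0.le).2 h2, ?_, ?_⟩
  · have hr6 : 6 * M < r := by
      have : 12 * M < s + r := by nlinarith
      linarith
    rcases lt_or_ge L (16 * M ^ 2) with hlt | hge
    · have hmul : 0 < (4 * M - s) * (4 * M - r) := by
        have : M * ((4 * M - s) * (4 * M - r)) = M * (16 * M ^ 2 - L) := by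
          linear_combination (s - 4 * M) * hsum - hqs
        rw [mul_left_cancel₀ hM.ne' this]
        linarith
      have : 4 * M < s := by
        by_contra! h
        nlinarith
      linarith
    · have hP4 : 0 < P (4 * M) := by
        have : P (4 * M) = 2 * M * (L - 16 * M ^ 2) + 64 * M ^ 3 * (1 - E ^ 2) := by
          simp only [hP]
          ring
        have h1 : 0 ≤ 2 * M * (L - 16 * M ^ 2) := mul_nonneg (by linarith) (by linarith)
        have h2 : 0 < 64 * M ^ 3 * (1 - E ^ 2) := by positivity
        linarith
      rw [hfac, mul_pos_iff_of_pos_left hEsq] at hP4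
      by_contra! h
      have : 0 ≤ (4 * M - r0) * (4 * M - r1) := mul_nonneg (by linarith) (by linarith)
      nlinarith
  · intro x hx hxE
    have hPx : P x = 0 := (Psi0_eq_iff hM hL0.le hx hE0.le).1 hxE
    rw [hfac] at hPx
    simpa [hEsq.ne', sub_eq_zero, or_assoc] using hPx
end

section
/- Under the stated assumptions, at every r > 0 with ρ(r) > 0 one has m(r) > 0, μ′(r) > 0, and the function u(r) := 1/(r³μ′(r)) − 1/r² has strictly negative derivative, u′(r) < 0. Consequently, for every L > 0 and every interval J ⊆ {r > 0 : ρ(r) > 0}, the derivative Ψ_L′ has at most one zero in J. -/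
open Real MeasureTheory Set intervalIntegral

/-- The mass function has derivative `4 π r² ρ(r)` away from the center. -/
lemma hasDerivAt_mass {ρ m : ℝ → ℝ} (hρcont : ContinuousOn ρ (Ioi 0))
    (hint : ∀ r : ℝ, 0 < r → IntegrableOn (fun s => s ^ 2 * ρ s) (Ioc 0 r))
    (hm : ∀ r : ℝ, m r = 4 * π * ∫ s in (0:ℝ)..r, s ^ 2 * ρ s) {r : ℝ} (hr : 0 < r) :
    HasDerivAt m (4 * π * (r ^ 2 * ρ r)) r := by
  have hc : ContinuousOn (fun s => s ^ 2 * ρ s) (Ioi 0) := by fun_prop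
  have h := integral_hasDerivAt_right
    ((intervalIntegrable_iff_integrableOn_Ioc_of_le hr.le).2 (hint r hr))
    (hc.stronglyMeasurableAtFilter isOpen_Ioi r hr) (hc.continuousAt (Ioi_mem_nhds hr))
  rw [funext hm]
  exact h.const_mul _

/-- The mass inside a radius of positive density is positive. -/
lemma mass_pos {ρ m : ℝ → ℝ} (hρcont : ContinuousOn ρ (Ioi 0))
    (hρ0 : ∀ r ∈ Ioi (0:ℝ), 0 ≤ ρ r)
    (hint : ∀ r : ℝ, 0 < r → IntegrableOn (fun s => s ^ 2 * ρ s) (Ioc 0 r))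
    (hm : ∀ r : ℝ, m r = 4 * π * ∫ s in (0:ℝ)..r, s ^ 2 * ρ s) {r : ℝ} (hr : 0 < r)
    (hρr : 0 < ρ r) : 0 < m r := by
  have hnonneg : ∀ s, 0 < s → 0 ≤ m s := by
    intro s hs
    rw [hm, integral_of_le hs.le]
    refine mul_nonneg (by positivity) (setIntegral_nonneg measurableSet_Ioc fun t ht => ?_)
    exact mul_nonneg (sq_nonneg t) (hρ0 t ht.1)
  refine lt_of_le_of_ne (hnonneg r hr) fun h0 => ?_
  have hmin : IsLocalMin m r := by
    filter_upwards [Ioi_mem_nhds hr] with s hs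
    rw [← h0]
    exact hnonneg s hs
  have h := hmin.hasDerivAt_eq_zero (hasDerivAt_mass hρcont hint hm hr)
  have : 0 < 4 * π * (r ^ 2 * ρ r) := by positivity
  exact this.ne' h

/-- The field equations in terms of `x = 2m/r`, `P = 8πr²p`, `R = 8πr²ρ`, `a = rμ'`,
`l = rλ'`, `b = r²μ''` force `2a² < 3a + b`. -/
lemma two_mul_sq_lt_of_field_eq {x P R a b l : ℝ} (hx0 : 0 < x) (hx : x ≤ 1 / 3) (hP : 0 ≤ P)
    (hR : 0 < R) (hPR : 3 * P ≤ R) (ha : (1 - x) * (2 * a + 1) - 1 = P)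
    (hl : 2 * l * (1 - x) = R - x)
    (hb : (1 - x) * (b + (a - l) * (a + 1)) = P) : 2 * a ^ 2 < 3 * a + b := by
  have hE : 0 < 1 - x := by linarith
  have key : 4 * (1 - x) ^ 2 * (3 * a + b - 2 * a ^ 2) =
      2 * x * (1 - 3 * x) + P * (14 - 18 * x) + (R - 3 * P) * (2 - x + P) := by
    obtain rfl : R = 2 * l * (1 - x) + x := by linarith
    subst ha
    linear_combination 4 * (1 - x) * hb
  have hpos : 0 < 2 * x * (1 - 3 * x) + P * (14 - 18 * x) + (R - 3 * P) * (2 - x + P) := by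
    have hx1 : 0 ≤ 2 * x * (1 - 3 * x) := mul_nonneg (by linarith) (by linarith)
    rcases hP.eq_or_lt with rfl | hP
    · have : 0 < (R - 3 * 0) * (2 - x + 0) := mul_pos (by linarith) (by linarith)
      linarith
    · have h1 : 0 < P * (14 - 18 * x) := mul_pos hP (by linarith)
      have h2 : 0 ≤ (R - 3 * P) * (2 - x + P) := mul_nonneg (by linarith) (by linarith)
      linarith
  rw [← key] at hpos
  have := (pos_iff_pos_of_mul_pos hpos).1 (by positivity)
  linarith

/-- Critical points of the effective potential solve `1/(r³μ') - 1/r² = 1/L`. -/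
lemma eq_inv_of_deriv_effectivePotential_eq_zero {μ : ℝ → ℝ} {L r : ℝ} (hL : 0 < L) (hr : 0 < r)
    (hμ : DifferentiableAt ℝ μ r) (hμ' : 0 < deriv μ r)
    (h : deriv (fun s => Real.exp (μ s) * Real.sqrt (1 + L / s ^ 2)) r = 0) :
    1 / (r ^ 3 * deriv μ r) - 1 / r ^ 2 = 1 / L := by
  have hpos : 0 < 1 + L / r ^ 2 := by positivity
  have hq : HasDerivAt (fun s : ℝ => 1 + L / s ^ 2) (-(2 * L / r ^ 3)) r := by
    have h1 := ((hasDerivAt_const r L).div (hasDerivAt_pow 2 r) (by positivity)).const_add 1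
    refine h1.congr_deriv ?_
    simp
    field_simp
  have hd := hμ.hasDerivAt.exp.mul (hq.sqrt hpos.ne')
  have h0 := hd.deriv.symm.trans h
  have hs : 0 < √(1 + L / r ^ 2) := Real.sqrt_pos.2 hpos
  have hs2 : √(1 + L / r ^ 2) ^ 2 = 1 + L / r ^ 2 := Real.sq_sqrt hpos.le
  generalize √(1 + L / r ^ 2) = w at h0 hs hs2
  have hexp := Real.exp_pos (μ r)
  have h3 : deriv μ r * w ^ 2 = L / r ^ 3 := by
    have : Real.exp (μ r) * (deriv μ r * w ^ 2 - L / r ^ 3) = 0 := by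
      field_simp at h0 ⊢
      linear_combination h0
    linarith [(mul_eq_zero.1 this).resolve_left hexp.ne']
  rw [hs2] at h3
  field_simp at h3 ⊢
  linear_combination -h3

theorem stmt_4
    (μ lam ρ p m : ℝ → ℝ)
    (hμ : ContDiffOn ℝ 2 μ (Ioi 0)) (hlam : ContDiffOn ℝ 1 lam (Ioi 0))
    (hρcont : ContinuousOn ρ (Ioi 0)) (hpcont : ContinuousOn p (Ioi 0))
    (hρ0 : ∀ r ∈ Ioi (0:ℝ), 0 ≤ ρ r) (hp0 : ∀ r ∈ Ioi (0:ℝ), 0 ≤ p r)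
    (hint : ∀ r : ℝ, 0 < r → IntegrableOn (fun s => s ^ 2 * ρ s) (Ioc 0 r))
    (hm : ∀ r : ℝ, m r = 4 * π * ∫ s in (0:ℝ)..r, s ^ 2 * ρ s)
    (h1 : ∀ r : ℝ, 0 < r → Real.exp (-2 * lam r) = 1 - 2 * m r / r)
    (h1' : ∀ r : ℝ, 0 < r → 2 * m r / r < 1)
    (h2 : ∀ r : ℝ, 0 < r →
      Real.exp (-2 * lam r) * (2 * r * deriv μ r + 1) - 1 = 8 * π * r ^ 2 * p r)
    (h3 : ∀ r : ℝ, 0 < r →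
      Real.exp (-2 * lam r) *
        (deriv (deriv μ) r + (deriv μ r - deriv lam r) * (deriv μ r + 1 / r)) = 8 * π * p r)
    (h4 : ∀ r : ℝ, 0 < r → 3 * p r ≤ ρ r)
    (h5 : ∀ r : ℝ, 0 < r → 2 * m r / r ≤ 1 / 3) :
    (∀ r : ℝ, 0 < r → 0 < ρ r →
      0 < m r ∧ 0 < deriv μ r ∧
      ∃ u' : ℝ, u' < 0 ∧
        HasDerivAt (fun s => 1 / (s ^ 3 * deriv μ s) - 1 / s ^ 2) u' r) ∧
    (∀ L : ℝ, 0 < L → ∀ J : Set ℝ, J ⊆ {r : ℝ | 0 < r ∧ 0 < ρ r} → J.OrdConnected →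
      ∀ x ∈ J, ∀ y ∈ J,
        deriv (fun s => Real.exp (μ s) * Real.sqrt (1 + L / s ^ 2)) x = 0 →
        deriv (fun s => Real.exp (μ s) * Real.sqrt (1 + L / s ^ 2)) y = 0 →
        x = y) := by
  have hdiff : ∀ r : ℝ, 0 < r → DifferentiableAt ℝ μ r := fun r hr =>
    (hμ.differentiableOn (by norm_num)).differentiableAt (Ioi_mem_nhds hr)
  have hdiff2 : ∀ r : ℝ, 0 < r → DifferentiableAt ℝ (deriv μ) r := fun r hr =>
    ((hμ.deriv_of_isOpen (m := 1) isOpen_Ioi (by norm_num)).differentiableOn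
      (by norm_num)).differentiableAt (Ioi_mem_nhds hr)
  have hu : ∀ r : ℝ, 0 < r → 0 < ρ r →
      0 < m r ∧ 0 < deriv μ r ∧
      ∃ u' : ℝ, u' < 0 ∧
        HasDerivAt (fun s => 1 / (s ^ 3 * deriv μ s) - 1 / s ^ 2) u' r := by
    intro r hr hρr
    have hmr := mass_pos hρcont hρ0 hint hm hr hρr
    have hx0 : 0 < 2 * m r / r := by positivity
    have hP : 0 ≤ 8 * π * r ^ 2 * p r := mul_nonneg (by positivity) (hp0 r hr)
    have e2 := h2 r hr
    have e3 := h3 r hr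
    rw [h1 r hr] at e2 e3
    have hμ' : 0 < deriv μ r := by
      have hE : 0 < 1 - 2 * m r / r := by linarith [h1' r hr]
      have h : 0 < (2 * r * (1 - 2 * m r / r)) * deriv μ r := by linarith
      exact (pos_iff_pos_of_mul_pos h).1 (by positivity)
    refine ⟨hmr, hμ', ?_⟩
    have hl : 2 * (r * deriv lam r) * (1 - 2 * m r / r)
        = 8 * π * r ^ 2 * ρ r - 2 * m r / r := by
      have hd1 := (((hlam.differentiableOn (by norm_num)).differentiableAt
        (Ioi_mem_nhds hr)).hasDerivAt.const_mul (-2)).exp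
      have hd2 := (((hasDerivAt_mass hρcont hint hm hr).const_mul 2).div
        (hasDerivAt_id r) hr.ne').const_sub 1
      have heq : (fun s => Real.exp (-2 * lam s)) =ᶠ[nhds r] fun s => 1 - 2 * m s / s := by
        filter_upwards [Ioi_mem_nhds hr] with s hs using h1 s hs
      have h := hd1.unique (hd2.congr_of_eventuallyEq heq)
      rw [h1 r hr] at h
      simp only [id] at h
      field_simp at h ⊢
      linear_combination -2 * h
    have hkey := two_mul_sq_lt_of_field_eq (a := r * deriv μ r) (b := r ^ 2 * deriv (deriv μ) r)
      (R := 8 * π * r ^ 2 * ρ r) hx0 (h5 r hr) hP (by positivity)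
      (by have := mul_le_mul_of_nonneg_left (h4 r hr) (by positivity : 0 ≤ 8 * π * r ^ 2)
          linarith)
      (by linear_combination e2) hl
      (by field_simp at e3 ⊢
          linear_combination e3)
    have hd1 := (hasDerivAt_const r (1:ℝ)).div
      ((hasDerivAt_pow 3 r).mul (hdiff2 r hr).hasDerivAt)
      (mul_pos (pow_pos hr 3) hμ').ne'
    have hd2 := (hasDerivAt_const r (1:ℝ)).div (hasDerivAt_pow 2 r) (by positivity)
    have hd := (hd1.sub hd2).congr_deriv
      (g' := (2 * (r * deriv μ r) ^ 2
        - (3 * (r * deriv μ r) + r ^ 2 * deriv (deriv μ) r)) / (r ^ 5 * deriv μ r ^ 2)) (by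
          simp only [Pi.mul_apply]
          field_simp
          simp
          ring)
    exact ⟨_, div_neg_of_neg_of_pos (by linarith) (by positivity), hd⟩
  refine ⟨hu, fun L hL J hJ hconn x hx y hy hx0 hy0 => ?_⟩
  have hanti : StrictAntiOn (fun s => 1 / (s ^ 3 * deriv μ s) - 1 / s ^ 2) J := by
    refine strictAntiOn_of_deriv_neg hconn.convex (fun s hs => ?_) fun s hs => ?_
    · obtain ⟨-, -, u', -, hd⟩ := hu s (hJ hs).1 (hJ hs).2
      exact hd.continuousAt.continuousWithinAt
    · have hs := hJ (interior_subset hs)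
      obtain ⟨-, -, u', hneg, hd⟩ := hu s hs.1 hs.2
      rwa [hd.deriv]
  refine hanti.injOn hx hy ?_
  have hcrit : ∀ z ∈ J, deriv (fun s => Real.exp (μ s) * Real.sqrt (1 + L / s ^ 2)) z = 0 →
      1 / (z ^ 3 * deriv μ z) - 1 / z ^ 2 = 1 / L := fun z hz =>
    eq_inv_of_deriv_effectivePotential_eq_zero hL (hJ hz).1 (hdiff z (hJ hz).1)
      (hu z (hJ hz).1 (hJ hz).2).2.1
  exact (hcrit x hx hx0).trans (hcrit y hy hy0).symm
end

section
/- Under the stated assumptions, for every L ≥ 0 and every r > 0 the identity (1/r²)·(r²·(Ψ_L²)′)′(r) = 2e^{2μ(r)+2λ(r)}·[4π(ρ(r)+3p(r)) + 4πr(p(r)+ρ(r))μ′(r) + (L/r²)·(4πr(p(r)+ρ(r))μ′(r) + 4π(ρ(r)−p(r)) + e^{−2λ(r)}/r² − 4m(r)/r³)] holds, and the right-hand side is strictly positive at every r with ρ(r) > 0. -/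
open Real MeasureTheory Set intervalIntegral

theorem hasDerivAt_four_pi_integral_sq_mul {ρ : ℝ → ℝ} (hρ : ContinuousOn ρ (Ioi 0)) {r : ℝ}
    (hr : 0 < r) (hint : IntegrableOn (fun s => s ^ 2 * ρ s) (Ioc 0 r)) :
    HasDerivAt (fun t => 4 * π * ∫ s in (0:ℝ)..t, s ^ 2 * ρ s) (4 * π * (r ^ 2 * ρ r)) r := by
  have hc : ContinuousOn (fun s => s ^ 2 * ρ s) (Ioi 0) := by fun_prop
  refine (intervalIntegral.integral_hasDerivAt_right ?_ ?_ ?_).const_mul _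
  · exact (intervalIntegrable_iff_integrableOn_Ioc_of_le hr.le).2 hint
  · exact hc.stronglyMeasurableAtFilter isOpen_Ioi r hr
  · exact hc.continuousAt (Ioi_mem_nhds hr)

/-- The derivative of the squared effective potential `(e ^ μ * √(1 + L / r ^ 2)) ^ 2`. -/
theorem hasDerivAt_sq_exp_mul_sqrt {μ : ℝ → ℝ} {r u L : ℝ} (hL : 0 ≤ L) (hr : 0 < r)
    (hμ : HasDerivAt μ u r) :
    HasDerivAt (fun t => (Real.exp (μ t) * Real.sqrt (1 + L / t ^ 2)) ^ 2)
      (Real.exp (2 * μ r) * (2 * u * (1 + L / r ^ 2) - 2 * L / r ^ 3)) r := by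
  have hsq : (fun t => (Real.exp (μ t) * Real.sqrt (1 + L / t ^ 2)) ^ 2) =
      fun t => Real.exp (2 * μ t) * (1 + L / t ^ 2) := by
    ext t
    rw [mul_pow, Real.sq_sqrt (by positivity), ← Real.exp_nat_mul]
    norm_num
  rw [hsq]
  have hdiv : HasDerivAt (fun t : ℝ => 1 + L / t ^ 2) (-(2 * L / r ^ 3)) r := by
    refine (((hasDerivAt_const r L).div (hasDerivAt_pow 2 r)
      (by positivity)).const_add 1).congr_deriv ?_
    field_simp
    norm_num
    ring
  refine ((hμ.const_mul 2).exp.mul hdiv).congr_deriv ?_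
  ring

/-- The radial Laplacian of the squared effective potential. -/
theorem deriv_sq_mul_deriv_sq_exp_mul_sqrt {μ : ℝ → ℝ} (hμ : ContDiffOn ℝ 2 μ (Ioi 0))
    {r L : ℝ} (hL : 0 ≤ L) (hr : 0 < r) :
    (1 / r ^ 2) * deriv (fun s => s ^ 2 *
        deriv (fun t => (Real.exp (μ t) * Real.sqrt (1 + L / t ^ 2)) ^ 2) s) r =
      2 * Real.exp (2 * μ r) *
        ((2 * deriv μ r ^ 2 + deriv (deriv μ) r) * (1 + L / r ^ 2) - 2 * deriv μ r * L / r ^ 3 +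
          2 * deriv μ r / r + L / r ^ 4) := by
  have hd : ∀ s : ℝ, 0 < s → HasDerivAt μ (deriv μ s) s := fun s hs =>
    ((hμ.differentiableOn (by norm_num)).differentiableAt (Ioi_mem_nhds hs)).hasDerivAt
  have hd2 : HasDerivAt (deriv μ) (deriv (deriv μ) r) r :=
    (((contDiffOn_succ_iff_deriv_of_isOpen (n := 1) isOpen_Ioi).1 hμ).2.2.differentiableOn
      (by norm_num) |>.differentiableAt (Ioi_mem_nhds hr)).hasDerivAt
  have hev : (fun s => s ^ 2 *
      deriv (fun t => (Real.exp (μ t) * Real.sqrt (1 + L / t ^ 2)) ^ 2) s) =ᶠ[nhds r]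
      fun s => Real.exp (2 * μ s) * (2 * deriv μ s * (s ^ 2 + L) - 2 * L * s⁻¹) := by
    filter_upwards [Ioi_mem_nhds hr] with s hs
    have hs' : (0:ℝ) < s := hs
    rw [(hasDerivAt_sq_exp_mul_sqrt hL hs' (hd s hs')).deriv]
    field_simp
  have hD := ((hd r hr).const_mul 2).exp.mul (((hd2.const_mul 2).mul
    ((hasDerivAt_pow 2 r).add_const L)).sub ((hasDerivAt_inv hr.ne').const_mul (2 * L)))
  rw [hev.deriv_eq]
  refine (congrArg _ hD.deriv).trans ?_
  simp only [Pi.mul_apply, Pi.sub_apply]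
  field_simp
  norm_num
  ring

theorem stmt_5
    (μ lam ρ p m : ℝ → ℝ)
    (hμ : ContDiffOn ℝ 2 μ (Ioi 0)) (hlam : ContDiffOn ℝ 1 lam (Ioi 0))
    (hρcont : ContinuousOn ρ (Ioi 0)) (hpcont : ContinuousOn p (Ioi 0))
    (hρ0 : ∀ r ∈ Ioi (0:ℝ), 0 ≤ ρ r) (hp0 : ∀ r ∈ Ioi (0:ℝ), 0 ≤ p r)
    (hint : ∀ r : ℝ, 0 < r → IntegrableOn (fun s => s ^ 2 * ρ s) (Ioc 0 r))
    (hm : ∀ r : ℝ, m r = 4 * π * ∫ s in (0:ℝ)..r, s ^ 2 * ρ s)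
    (h1 : ∀ r : ℝ, 0 < r → Real.exp (-2 * lam r) = 1 - 2 * m r / r)
    (h1' : ∀ r : ℝ, 0 < r → 2 * m r / r < 1)
    (h2 : ∀ r : ℝ, 0 < r →
      Real.exp (-2 * lam r) * (2 * r * deriv μ r + 1) - 1 = 8 * π * r ^ 2 * p r)
    (h3 : ∀ r : ℝ, 0 < r →
      Real.exp (-2 * lam r) *
        (deriv (deriv μ) r + (deriv μ r - deriv lam r) * (deriv μ r + 1 / r)) = 8 * π * p r)
    (h4 : ∀ r : ℝ, 0 < r → 3 * p r ≤ ρ r)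
    (h5 : ∀ r : ℝ, 0 < r → 2 * m r / r ≤ 1 / 3) :
    ∀ L : ℝ, 0 ≤ L → ∀ r : ℝ, 0 < r →
      ((1 / r ^ 2) *
          deriv (fun s => s ^ 2 *
            deriv (fun t => (Real.exp (μ t) * Real.sqrt (1 + L / t ^ 2)) ^ 2) s) r =
        2 * Real.exp (2 * μ r + 2 * lam r) *
          (4 * π * (ρ r + 3 * p r) + 4 * π * r * (p r + ρ r) * deriv μ r +
            (L / r ^ 2) * (4 * π * r * (p r + ρ r) * deriv μ r + 4 * π * (ρ r - p r) +
              Real.exp (-2 * lam r) / r ^ 2 - 4 * m r / r ^ 3))) ∧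
      (0 < ρ r →
        0 < 2 * Real.exp (2 * μ r + 2 * lam r) *
          (4 * π * (ρ r + 3 * p r) + 4 * π * r * (p r + ρ r) * deriv μ r +
            (L / r ^ 2) * (4 * π * r * (p r + ρ r) * deriv μ r + 4 * π * (ρ r - p r) +
              Real.exp (-2 * lam r) / r ^ 2 - 4 * m r / r ^ 3))) := by
  intro L hL r hr
  have hr0 : r ≠ 0 := hr.ne'
  have hE := Real.exp_pos (-2 * lam r)
  have hexp : Real.exp (2 * μ r + 2 * lam r) = Real.exp (2 * μ r) / Real.exp (-2 * lam r) := by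
    rw [← Real.exp_sub]; ring_nf
  have hmd : HasDerivAt m (4 * π * (r ^ 2 * ρ r)) r := by
    rw [funext hm]
    exact hasDerivAt_four_pi_integral_sq_mul hρcont hr (hint r hr)
  have hlamd : HasDerivAt lam (deriv lam r) r :=
    ((hlam.differentiableOn (by norm_num)).differentiableAt (Ioi_mem_nhds hr)).hasDerivAt
  have hlamE : 2 * Real.exp (-2 * lam r) * deriv lam r = 8 * π * r * ρ r - 2 * m r / r ^ 2 := by
    have hl := (hlamd.const_mul (-2)).exp
    have hq := ((hmd.const_mul 2).div (hasDerivAt_id r) hr0).const_sub 1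
    have hev : (fun s => Real.exp (-2 * lam s)) =ᶠ[nhds r] fun s => 1 - 2 * m s / s := by
      filter_upwards [Ioi_mem_nhds hr] with s hs using h1 s hs
    have heq := hl.unique (hq.congr_of_eventuallyEq hev)
    simp only [id] at heq
    field_simp at heq ⊢
    linarith
  have hm0 : 0 ≤ m r := by
    rw [hm r]
    refine mul_nonneg (by positivity)
      (intervalIntegral.integral_nonneg_of_ae_restrict hr.le ?_)
    rw [Filter.EventuallyLE, ← restrict_Ioc_eq_restrict_Icc]
    filter_upwards [ae_restrict_mem measurableSet_Ioc] with s hs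
    exact mul_nonneg (sq_nonneg s) (hρ0 s hs.1)
  have hp := hp0 r hr
  have hρ := hρ0 r hr
  have e1 := h1 r hr
  have e2 := h2 r hr
  have e3 := h3 r hr
  rw [hexp]
  constructor
  · rw [deriv_sq_mul_deriv_sq_exp_mul_sqrt hμ hL hr]
    generalize Real.exp (-2 * lam r) = E at *
    generalize deriv (deriv μ) r = w at *
    generalize deriv μ r = u at *
    generalize deriv lam r = l at *
    have hu : E * u = 4 * π * r * p r + m r / r ^ 2 := by
      field_simp at e1 e2 ⊢
      linear_combination (r / 2) * e2 - e1 / 2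
    have hul : E * (u + l) = 4 * π * r * (p r + ρ r) := by
      linear_combination hu + hlamE / 2
    have hbase : E * (2 * u ^ 2 + w) =
        8 * π * p r + 4 * π * r * (p r + ρ r) * (u + 1 / r) - 2 * (E * u) / r := by
      linear_combination e3 + (u + 1 / r) * hul
    have key : E * ((2 * u ^ 2 + w) * (1 + L / r ^ 2) - 2 * u * L / r ^ 3 + 2 * u / r + L / r ^ 4) =
        4 * π * (ρ r + 3 * p r) + 4 * π * r * (p r + ρ r) * u +
          (L / r ^ 2) * (4 * π * r * (p r + ρ r) * u + 4 * π * (ρ r - p r) +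
            E / r ^ 2 - 4 * m r / r ^ 3) := by
      have hsplit : E * ((2 * u ^ 2 + w) * (1 + L / r ^ 2) - 2 * u * L / r ^ 3 + 2 * u / r +
          L / r ^ 4) = E * (2 * u ^ 2 + w) * (1 + L / r ^ 2) - 2 * (E * u) * L / r ^ 3 +
          2 * (E * u) / r + E * L / r ^ 4 := by ring
      rw [hsplit, hbase, hu]
      field_simp
      ring
    rw [← key]
    field_simp
  · intro hρpos
    have hu : 0 ≤ deriv μ r := by
      have hpos : 0 ≤ Real.exp (-2 * lam r) * (2 * r * deriv μ r) := by
        have : 0 ≤ 8 * π * r ^ 2 * p r := by positivity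
        have : 0 ≤ 2 * m r / r := by positivity
        linarith
      exact nonneg_of_mul_nonneg_right (nonneg_of_mul_nonneg_right hpos hE) (by positivity)
    have hρp : 0 ≤ ρ r - p r := by linarith [h4 r hr]
    have hgeom : 0 ≤ Real.exp (-2 * lam r) / r ^ 2 - 4 * m r / r ^ 3 := by
      have : Real.exp (-2 * lam r) / r ^ 2 - 4 * m r / r ^ 3 =
          (1 - 3 * (2 * m r / r)) / r ^ 2 := by
        rw [e1]
        field_simp
        ring
      rw [this]
      exact div_nonneg (by linarith [h5 r hr]) (by positivity)
    rw [add_sub_assoc]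
    positivity
end

section
/- Let a, q > 0, E ∈ ℝ, r* ∈ ℝ, and let Ψ : [r*, r*+q] → ℝ be twice continuously differentiable with Ψ′(r*) = 0, Ψ″(r) ≥ a for all r ∈ [r*, r*+q], and Ψ(r) ≤ E for all r ∈ [r*, r*+q]. Then Ψ(r) < E for r ∈ [r*, r*+q) and the (improper) integral satisfies ∫_{r*}^{r*+q} (E − Ψ(r))^{−1/2} dr ≤ π/√(2a). -/
open Real MeasureTheory Set

/-- A function with nonnegative one-sided derivative on a compact interval is monotone there. -/
theorem monotoneOn_Icc_of_hasDerivWithinAt_nonneg {f f' : ℝ → ℝ} {x y : ℝ}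
    (hf : ∀ r ∈ Icc x y, HasDerivWithinAt f (f' r) (Icc x y) r)
    (hf' : ∀ r ∈ Icc x y, 0 ≤ f' r) : MonotoneOn f (Icc x y) :=
  monotoneOn_of_hasDerivWithinAt_nonneg (convex_Icc x y)
    (fun r hr => (hf r hr).continuousWithinAt)
    (fun r hr => (hf r (interior_subset hr)).mono interior_subset)
    (fun r hr => hf' r (interior_subset hr))

/-- The arcsine integral `∫ dr / √(c² q² (1 - ((r - s) / q)²)) = π / (2 c)` over `(s, s + q]`. -/
theorem lintegral_inv_sqrt_one_sub_sq (s : ℝ) {q c : ℝ} (hq : 0 < q) (hc : 0 < c) :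
    ∫⁻ r in Ioc s (s + q), ENNReal.ofReal (c⁻¹ * (1 / √(1 - ((r - s) / q) ^ 2) * (1 / q))) =
      ENNReal.ofReal (π / (2 * c)) := by
  have hsq : s ≤ s + q := by linarith
  have hcont : ContinuousOn (fun r => c⁻¹ * arcsin ((r - s) / q)) (Icc s (s + q)) := by
    have : Continuous fun r => c⁻¹ * arcsin ((r - s) / q) :=
      continuous_const.mul (continuous_arcsin.comp (by fun_prop))
    exact this.continuousOn
  have hderiv : ∀ r ∈ Ioo s (s + q), HasDerivAt (fun r => c⁻¹ * arcsin ((r - s) / q))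
      (c⁻¹ * (1 / √(1 - ((r - s) / q) ^ 2) * (1 / q))) r := by
    intro r hr
    have h0 : 0 < (r - s) / q := div_pos (by linarith [hr.1]) hq
    have h1 : (r - s) / q < 1 := (div_lt_one hq).2 (by linarith [hr.2])
    exact ((hasDerivAt_arcsin (by linarith) h1.ne).comp r
      (((hasDerivAt_id r).sub_const s).div_const q)).const_mul _
  have hnonneg : ∀ r, 0 ≤ c⁻¹ * (1 / √(1 - ((r - s) / q) ^ 2) * (1 / q)) := by
    intro r
    positivity
  have hint := intervalIntegral.integrableOn_deriv_of_nonneg hcont hderiv fun r _ => hnonneg r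
  have hval := intervalIntegral.integral_eq_sub_of_hasDerivAt_of_le hsq hcont hderiv
    ((intervalIntegrable_iff_integrableOn_Ioc_of_le hsq).2 hint)
  rw [← ofReal_integral_eq_lintegral_ofReal hint (ae_of_all _ hnonneg),
    ← intervalIntegral.integral_of_le hsq, hval]
  congr 1
  simp only [add_sub_cancel_left, sub_self, zero_div, div_self hq.ne', arcsin_one, arcsin_zero]
  field_simp
  ring

theorem stmt_6 (a q E rstar : ℝ) (ha : 0 < a) (hq : 0 < q)
    (Ψ Ψ' Ψ'' : ℝ → ℝ)
    (hd1 : ∀ r ∈ Icc rstar (rstar + q),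
      HasDerivWithinAt Ψ (Ψ' r) (Icc rstar (rstar + q)) r)
    (hd2 : ∀ r ∈ Icc rstar (rstar + q),
      HasDerivWithinAt Ψ' (Ψ'' r) (Icc rstar (rstar + q)) r)
    (hc : ContinuousOn Ψ'' (Icc rstar (rstar + q)))
    (h0 : Ψ' rstar = 0)
    (hconv : ∀ r ∈ Icc rstar (rstar + q), a ≤ Ψ'' r)
    (hle : ∀ r ∈ Icc rstar (rstar + q), Ψ r ≤ E) :
    (∀ r ∈ Ico rstar (rstar + q), Ψ r < E) ∧
    ∫⁻ r in Ioc rstar (rstar + q), ENNReal.ofReal ((E - Ψ r) ^ (-(1/2) : ℝ)) ≤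
      ENNReal.ofReal (π / Real.sqrt (2 * a)) := by
  have hsq : rstar ≤ rstar + q := by linarith
  have hlin : ∀ r, HasDerivWithinAt (fun r => a * (r - rstar)) a (Icc rstar (rstar + q)) r := by
    intro r
    simpa using (((hasDerivAt_id r).sub_const rstar).const_mul a).hasDerivWithinAt
  have hquad : ∀ r, HasDerivWithinAt (fun r => a / 2 * (r - rstar) ^ 2) (a * (r - rstar))
      (Icc rstar (rstar + q)) r := by
    intro r
    have := ((((hasDerivAt_id r).sub_const rstar).pow 2).const_mul (a / 2)).hasDerivWithinAt
      (s := Icc rstar (rstar + q))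
    refine this.congr_deriv ?_
    simp
    ring
  have hm1 : MonotoneOn (fun r => Ψ' r - a * (r - rstar)) (Icc rstar (rstar + q)) :=
    monotoneOn_Icc_of_hasDerivWithinAt_nonneg (fun r hr => (hd2 r hr).sub (hlin r))
      fun r hr => sub_nonneg.2 (hconv r hr)
  have hm2 : MonotoneOn (fun r => Ψ r - a / 2 * (r - rstar) ^ 2) (Icc rstar (rstar + q)) := by
    refine monotoneOn_Icc_of_hasDerivWithinAt_nonneg (fun r hr => (hd1 r hr).sub (hquad r)) ?_
    intro r hr
    simpa [h0] using hm1 (left_mem_Icc.2 hsq) hr hr.1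
  have hgap : ∀ r ∈ Icc rstar (rstar + q), a / 2 * (q ^ 2 - (r - rstar) ^ 2) ≤ E - Ψ r := by
    intro r hr
    have h1 := hm2 hr (right_mem_Icc.2 hsq) hr.2
    have h2 := hle _ (right_mem_Icc.2 hsq)
    simp only [add_sub_cancel_left] at h1
    linarith
  have hpos : ∀ r ∈ Ico rstar (rstar + q), 0 < a / 2 * (q ^ 2 - (r - rstar) ^ 2) := by
    intro r hr
    refine mul_pos (by linarith) (sub_pos.2 ?_)
    exact pow_lt_pow_left₀ (by linarith [hr.2]) (by linarith [hr.1]) two_ne_zero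
  refine ⟨fun r hr => by linarith [hpos r hr, hgap r (Ico_subset_Icc_self hr)], ?_⟩
  have h2a : √(2 * a) = 2 * √(a / 2) := by
    rw [show 2 * a = 2 ^ 2 * (a / 2) by ring, sqrt_mul (by norm_num), sqrt_sq (by norm_num)]
  rw [h2a, ← lintegral_inv_sqrt_one_sub_sq rstar hq (sqrt_pos.2 (half_pos ha)),
    ← restrict_Ioo_eq_restrict_Ioc]
  refine setLIntegral_mono' measurableSet_Ioo fun r hr => ENNReal.ofReal_le_ofReal ?_
  have hD := hpos r (Ioo_subset_Ico_self hr)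
  calc (E - Ψ r) ^ (-(1/2) : ℝ)
      ≤ (a / 2 * (q ^ 2 - (r - rstar) ^ 2)) ^ (-(1/2) : ℝ) :=
        rpow_le_rpow_of_nonpos hD (hgap r (Ioo_subset_Icc_self hr)) (by norm_num)
    _ = (√(a / 2 * (q ^ 2 - (r - rstar) ^ 2)))⁻¹ := by rw [rpow_neg hD.le, sqrt_eq_rpow]
    _ = (√(a / 2) * (q * √(1 - ((r - rstar) / q) ^ 2)))⁻¹ := by
        rw [show q ^ 2 - (r - rstar) ^ 2 = q ^ 2 * (1 - ((r - rstar) / q) ^ 2) by field_simp,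
          sqrt_mul (by positivity), sqrt_mul (by positivity), sqrt_sq hq.le]
    _ = (√(a / 2))⁻¹ * (1 / √(1 - ((r - rstar) / q) ^ 2) * (1 / q)) := by
        rw [mul_inv, mul_inv, one_div, one_div, mul_comm q⁻¹]
end

section
/- For every continuously differentiable f with compact support contained in (0,∞) × ℝ × (0,∞) and all r > 0, the following identities hold: p_f′(r) = −μ₀′(r)·(p_f(r) + ρ_f(r)) − (2/r)·(p_f(r) − q_f(r)) − e^{λ₀(r)−μ₀(r)}·j_{Tf}(r), and j_f′(r) = −2·(μ₀′(r) + 1/r)·j_f(r) − e^{λ₀(r)−μ₀(r)}·ρ_{Tf}(r). -/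
open Real MeasureTheory Set

noncomputable section

/-- `⟨v⟩ = √(1 + w² + L/r²)`. -/
def vbar (r w L : ℝ) : ℝ := Real.sqrt (1 + w ^ 2 + L / r ^ 2)

/-- The density `ρ_f`. -/
def rhoF (f : ℝ × ℝ × ℝ → ℝ) (r : ℝ) : ℝ :=
  π / r ^ 2 * ∫ L in Ioi (0:ℝ), ∫ w : ℝ, vbar r w L * f (r, w, L)

/-- The radial pressure `p_f`. -/
def pF (f : ℝ × ℝ × ℝ → ℝ) (r : ℝ) : ℝ :=
  π / r ^ 2 * ∫ L in Ioi (0:ℝ), ∫ w : ℝ, w ^ 2 / vbar r w L * f (r, w, L)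

/-- The momentum density `j_f`. -/
def jF (f : ℝ × ℝ × ℝ → ℝ) (r : ℝ) : ℝ :=
  π / r ^ 2 * ∫ L in Ioi (0:ℝ), ∫ w : ℝ, w * f (r, w, L)

/-- The tangential pressure `q_f`. -/
def qF (f : ℝ × ℝ × ℝ → ℝ) (r : ℝ) : ℝ :=
  π / (2 * r ^ 2) * ∫ L in Ioi (0:ℝ), ∫ w : ℝ, (L / (r ^ 2 * vbar r w L)) * f (r, w, L)

/-- The transport operator `T`. -/
def TranspOp (μ₀ lam0 : ℝ → ℝ) (f : ℝ × ℝ × ℝ → ℝ) : ℝ × ℝ × ℝ → ℝ := fun x =>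
  -Real.exp (μ₀ x.1 - lam0 x.1) *
    ((x.2.1 / vbar x.1 x.2.1 x.2.2) * deriv (fun r => f (r, x.2.1, x.2.2)) x.1 -
      (deriv μ₀ x.1 * vbar x.1 x.2.1 x.2.2 - x.2.2 / (x.1 ^ 3 * vbar x.1 x.2.1 x.2.2)) *
        deriv (fun w => f (x.1, w, x.2.2)) x.2.1)

/-- The integral of `g (r, w, L)` over `w ∈ ℝ` and `L > 0`. -/
def momentumIntegral (g : ℝ × ℝ × ℝ → ℝ) (r : ℝ) : ℝ :=
  ∫ L in Ioi (0:ℝ), ∫ w : ℝ, g (r, w, L)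

lemma momentumIntegral_congr {g h : ℝ × ℝ × ℝ → ℝ} {r : ℝ}
    (H : ∀ w L, 0 < L → g (r, w, L) = h (r, w, L)) :
    momentumIntegral g r = momentumIntegral h r :=
  setIntegral_congr_fun measurableSet_Ioi fun L hL =>
    integral_congr_ae (Filter.Eventually.of_forall fun w => H w L hL)

lemma momentumIntegral_const_mul (g : ℝ × ℝ × ℝ → ℝ) (c r : ℝ) :
    momentumIntegral (fun x => c * g x) r = c * momentumIntegral g r := by
  simp only [momentumIntegral, integral_const_mul]

lemma integrable_slice {g : ℝ × ℝ × ℝ → ℝ} (hg : Continuous g) (hs : HasCompactSupport g)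
    (r : ℝ) :
    Integrable (fun p : ℝ × ℝ => g (r, p.2, p.1)) ((volume.restrict (Ioi (0:ℝ))).prod volume) := by
  have hc : Continuous fun p : ℝ × ℝ => g (r, p.2, p.1) := by fun_prop
  refine hc.integrable_of_hasCompactSupport
    (HasCompactSupport.intro (hs.isCompact.image
      (show Continuous fun x : ℝ × ℝ × ℝ => (x.2.2, x.2.1) by fun_prop)) fun p hp => ?_)
  by_contra h
  exact hp ⟨(r, p.2, p.1), subset_tsupport g h, rfl⟩

lemma momentumIntegral_eq_integral_prod {g : ℝ × ℝ × ℝ → ℝ} (hg : Continuous g)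
    (hs : HasCompactSupport g) (r : ℝ) :
    momentumIntegral g r =
      ∫ p : ℝ × ℝ, g (r, p.2, p.1) ∂((volume.restrict (Ioi (0:ℝ))).prod volume) :=
  (integral_prod _ (integrable_slice hg hs r)).symm

lemma continuous_hasCompactSupport_add_const_mul {g h : ℝ × ℝ × ℝ → ℝ}
    (hg : Continuous g ∧ HasCompactSupport g) (hh : Continuous h ∧ HasCompactSupport h) (c : ℝ) :
    Continuous (fun x => g x + c * h x) ∧ HasCompactSupport fun x => g x + c * h x :=
  ⟨hg.1.add (continuous_const.mul hh.1), hg.2.add (hh.2.mul_left (f := fun _ => c))⟩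

lemma momentumIntegral_add_const_mul {g h : ℝ × ℝ × ℝ → ℝ}
    (hg : Continuous g ∧ HasCompactSupport g) (hh : Continuous h ∧ HasCompactSupport h)
    (c r : ℝ) :
    momentumIntegral (fun x => g x + c * h x) r =
      momentumIntegral g r + c * momentumIntegral h r := by
  have hgh := continuous_hasCompactSupport_add_const_mul hg hh c
  rw [momentumIntegral_eq_integral_prod hg.1 hg.2, momentumIntegral_eq_integral_prod hh.1 hh.2,
    momentumIntegral_eq_integral_prod hgh.1 hgh.2,
    integral_add (integrable_slice hg.1 hg.2 r) ((integrable_slice hh.1 hh.2 r).const_mul c),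
    integral_const_mul]

lemma hasDerivAt_slice_radius {g : ℝ × ℝ × ℝ → ℝ} (hg : ContDiff ℝ 1 g) (r w L : ℝ) :
    HasDerivAt (fun s => g (s, w, L)) (fderiv ℝ g (r, w, L) (1, 0, 0)) r :=
  ((hg.differentiable one_ne_zero (r, w, L)).hasFDerivAt).comp_hasDerivAt r
    ((hasDerivAt_id r).prodMk ((hasDerivAt_const r w).prodMk (hasDerivAt_const r L)))

lemma hasDerivAt_slice_momentum {g : ℝ × ℝ × ℝ → ℝ} (hg : ContDiff ℝ 1 g) (r w L : ℝ) :
    HasDerivAt (fun s => g (r, s, L)) (fderiv ℝ g (r, w, L) (0, 1, 0)) w :=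
  ((hg.differentiable one_ne_zero (r, w, L)).hasFDerivAt).comp_hasDerivAt w
    ((hasDerivAt_const w r).prodMk ((hasDerivAt_id w).prodMk (hasDerivAt_const w L)))

lemma continuous_fderiv_apply_const {g : ℝ × ℝ × ℝ → ℝ} (hg : ContDiff ℝ 1 g) (v : ℝ × ℝ × ℝ) :
    Continuous fun x => fderiv ℝ g x v :=
  (hg.continuous_fderiv one_ne_zero).clm_apply continuous_const

lemma hasDerivAt_momentumIntegral {g : ℝ × ℝ × ℝ → ℝ} (hg : ContDiff ℝ 1 g)
    (hs : HasCompactSupport g) (r : ℝ) :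
    HasDerivAt (momentumIntegral g)
      (momentumIntegral (fun x => fderiv ℝ g x (1, 0, 0)) r) r := by
  have hc := continuous_fderiv_apply_const hg (1, 0, 0)
  have hcs : HasCompactSupport fun x => fderiv ℝ g x (1, 0, 0) := hs.fderiv_apply ℝ _
  rw [momentumIntegral_eq_integral_prod hc hcs,
    funext (momentumIntegral_eq_integral_prod hg.continuous hs)]
  obtain ⟨C, hC⟩ := hcs.exists_bound_of_continuous hc
  have hS : IsCompact ((fun x : ℝ × ℝ × ℝ => (x.2.2, x.2.1)) ''
      tsupport fun x => fderiv ℝ g x (1, 0, 0)) := hcs.isCompact.image (by fun_prop)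
  set S := (fun x : ℝ × ℝ × ℝ => (x.2.2, x.2.1)) '' tsupport fun x => fderiv ℝ g x (1, 0, 0)
  refine (hasDerivAt_integral_of_dominated_loc_of_deriv_le (bound := S.indicator fun _ => C)
    (F' := fun s p => fderiv ℝ g (s, p.2, p.1) (1, 0, 0)) Filter.univ_mem
    (Filter.Eventually.of_forall fun s =>
      (integrable_slice hg.continuous hs s).aestronglyMeasurable)
    (integrable_slice hg.continuous hs r) (integrable_slice hc hcs r).aestronglyMeasurable
    (Filter.Eventually.of_forall fun p s _ => ?_) ?_
    (Filter.Eventually.of_forall fun p s _ => hasDerivAt_slice_radius hg s p.2 p.1)).2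
  · by_cases hp : p ∈ S
    · rw [indicator_of_mem hp]
      exact hC _
    · rw [indicator_of_notMem hp, norm_le_zero_iff]
      by_contra h
      exact hp ⟨(s, p.2, p.1), subset_tsupport (fun x => fderiv ℝ g x (1, 0, 0)) h, rfl⟩
  · rw [integrable_indicator_iff hS.measurableSet]
    exact integrableOn_const hS.measure_lt_top.ne

lemma hasCompactSupport_momentum_slice {g : ℝ × ℝ × ℝ → ℝ} (hs : HasCompactSupport g) (r L : ℝ) :
    HasCompactSupport fun w => g (r, w, L) := by
  refine HasCompactSupport.intro (hs.isCompact.image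
    (show Continuous fun x : ℝ × ℝ × ℝ => x.2.1 by fun_prop)) fun w hw => ?_
  by_contra h
  exact hw ⟨(r, w, L), subset_tsupport g h, rfl⟩

lemma momentumIntegral_fderiv_momentum {g : ℝ × ℝ × ℝ → ℝ} (hg : ContDiff ℝ 1 g)
    (hs : HasCompactSupport g) (r : ℝ) :
    momentumIntegral (fun x => fderiv ℝ g x (0, 1, 0)) r = 0 := by
  have hc := continuous_fderiv_apply_const hg (0, 1, 0)
  have hcs : HasCompactSupport fun x => fderiv ℝ g x (0, 1, 0) := hs.fderiv_apply ℝ _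
  have hgc := hg.continuous
  have key (L : ℝ) : ∫ w : ℝ, fderiv ℝ g (r, w, L) (0, 1, 0) = 0 :=
    integral_eq_zero_of_hasDerivAt_of_integrable
      (fun w => hasDerivAt_slice_momentum hg r w L)
      ((hc.comp (by fun_prop : Continuous fun w : ℝ => (r, w, L))).integrable_of_hasCompactSupport
        (hasCompactSupport_momentum_slice hcs r L))
      ((by fun_prop : Continuous fun w : ℝ => g (r, w, L)).integrable_of_hasCompactSupport
        (hasCompactSupport_momentum_slice hs r L))
  simp [momentumIntegral, key]

lemma contDiff_weight_mul {f k : ℝ × ℝ × ℝ → ℝ} (hf : ContDiff ℝ 1 f)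
    (hsub : tsupport f ⊆ Ioi (0:ℝ) ×ˢ (univ : Set ℝ) ×ˢ Ioi (0:ℝ))
    (hk : ∀ r w L, 0 < r → 0 < L → ContDiffAt ℝ 1 k (r, w, L)) :
    ContDiff ℝ 1 fun x => k x * f x := by
  refine contDiff_iff_contDiffAt.2 fun x => ?_
  by_cases hx : x ∈ tsupport f
  · exact (hk x.1 x.2.1 x.2.2 (hsub hx).1 (hsub hx).2.2).mul hf.contDiffAt
  · refine (contDiffAt_const (c := (0:ℝ))).congr_of_eventuallyEq ?_
    filter_upwards [notMem_tsupport_iff_eventuallyEq.1 hx] with y hy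
    simp [hy]

lemma vbar_arg_pos {r L : ℝ} (w : ℝ) (hr : 0 < r) (hL : 0 < L) : 0 < 1 + w ^ 2 + L / r ^ 2 := by
  positivity

lemma vbar_pos {r L : ℝ} (w : ℝ) (hr : 0 < r) (hL : 0 < L) : 0 < vbar r w L :=
  Real.sqrt_pos.2 (vbar_arg_pos w hr hL)

lemma contDiffAt_vbar {r L : ℝ} (w : ℝ) (hr : 0 < r) (hL : 0 < L) :
    ContDiffAt ℝ 1 (fun x : ℝ × ℝ × ℝ => vbar x.1 x.2.1 x.2.2) (r, w, L) := by
  unfold vbar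
  refine ContDiffAt.sqrt ?_ (vbar_arg_pos w hr hL).ne'
  have : r ^ 2 ≠ 0 := by positivity
  fun_prop (disch := assumption)

lemma hasDerivAt_vbar_radius {r L : ℝ} (w : ℝ) (hr : 0 < r) (hL : 0 < L) :
    HasDerivAt (fun s => vbar s w L) (-(L / (r ^ 3 * vbar r w L))) r := by
  have hv := vbar_pos w hr hL
  have h := ((((hasDerivAt_pow 2 r).inv (by positivity)).const_mul L).const_add
    (1 + w ^ 2)).sqrt (vbar_arg_pos w hr hL).ne'
  convert h using 1
  · rfl
  change _ = _ / (2 * vbar r w L)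
  field_simp
  norm_num [mul_comm]

lemma hasDerivAt_vbar_momentum {r L : ℝ} (w : ℝ) (hr : 0 < r) (hL : 0 < L) :
    HasDerivAt (fun s => vbar r s L) (w / vbar r w L) w := by
  have hv := vbar_pos w hr hL
  have h := (((hasDerivAt_pow 2 w).const_add 1).add_const (L / r ^ 2)).sqrt
    (vbar_arg_pos w hr hL).ne'
  convert h using 1
  · rfl
  change _ = _ / (2 * vbar r w L)
  field_simp
  norm_num [mul_comm]

lemma transpOp_eq {f : ℝ × ℝ × ℝ → ℝ} (hf : ContDiff ℝ 1 f) (μ₀ lam0 : ℝ → ℝ) (r w L : ℝ) :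
    TranspOp μ₀ lam0 f (r, w, L) = -Real.exp (μ₀ r - lam0 r) *
      ((w / vbar r w L) * fderiv ℝ f (r, w, L) (1, 0, 0) -
        (deriv μ₀ r * vbar r w L - L / (r ^ 3 * vbar r w L)) *
          fderiv ℝ f (r, w, L) (0, 1, 0)) := by
  simp only [TranspOp, (hasDerivAt_slice_radius hf r w L).deriv,
    (hasDerivAt_slice_momentum hf r w L).deriv]

/-- `w T f` is, up to a `w`-derivative, the `r`-derivative of the pressure integrand plus terms
of order zero in `f`. -/
lemma momentum_mul_transpOp {f : ℝ × ℝ × ℝ → ℝ} (hf : ContDiff ℝ 1 f) (μ₀ lam0 : ℝ → ℝ)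
    {K H : ℝ × ℝ × ℝ → ℝ} (hK : ContDiff ℝ 1 K) (hH : ContDiff ℝ 1 H) {r L : ℝ} (w : ℝ)
    (hr : 0 < r) (hL : 0 < L)
    (hKf : ∀ x, K x = x.2.1 ^ 2 / vbar x.1 x.2.1 x.2.2 * f x)
    (hHf : ∀ x, H x = x.2.1 * (deriv μ₀ r * vbar x.1 x.2.1 x.2.2 -
      x.2.2 / (x.1 ^ 3 * vbar x.1 x.2.1 x.2.2)) * f x) :
    w * TranspOp μ₀ lam0 f (r, w, L) = -Real.exp (μ₀ r - lam0 r) *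
      (fderiv ℝ K (r, w, L) (1, 0, 0) + (-1) * fderiv ℝ H (r, w, L) (0, 1, 0) +
        deriv μ₀ r * (vbar r w L * f (r, w, L)) + deriv μ₀ r * K (r, w, L) +
        (-1 / r) * (L / (r ^ 2 * vbar r w L) * f (r, w, L))) := by
  have hv := vbar_pos w hr hL
  have hv0 := hv.ne'
  have hK' := (((hasDerivAt_const r (w ^ 2)).div (hasDerivAt_vbar_radius w hr hL) hv0).mul
    (hasDerivAt_slice_radius hf r w L)).unique
      ((hasDerivAt_slice_radius hK r w L).congr_of_eventuallyEq
        (Filter.Eventually.of_forall fun s => (hKf (s, w, L)).symm))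
  have hH' := ((((hasDerivAt_id w).mul (((hasDerivAt_vbar_momentum w hr hL).const_mul
      (deriv μ₀ r)).sub ((hasDerivAt_const w L).div
        ((hasDerivAt_vbar_momentum w hr hL).const_mul (r ^ 3)) (by positivity)))).mul
    (hasDerivAt_slice_momentum hf r w L))).unique
      ((hasDerivAt_slice_momentum hH r w L).congr_of_eventuallyEq
        (Filter.Eventually.of_forall fun s => (hHf (r, s, L)).symm))
  rw [← hK', ← hH', transpOp_eq hf, hKf]
  simp only [id, Pi.mul_apply, Pi.div_apply, Pi.sub_apply]
  field_simp
  ring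

/-- `⟨v⟩ T f` is, up to a `w`-derivative, the `r`-derivative of the momentum density integrand
plus terms of order zero in `f`. -/
lemma vbar_mul_transpOp {f : ℝ × ℝ × ℝ → ℝ} (hf : ContDiff ℝ 1 f) (μ₀ lam0 : ℝ → ℝ)
    {K H : ℝ × ℝ × ℝ → ℝ} (hK : ContDiff ℝ 1 K) (hH : ContDiff ℝ 1 H) {r L : ℝ} (w : ℝ)
    (hr : 0 < r) (hL : 0 < L)
    (hKf : ∀ x, K x = x.2.1 * f x)
    (hHf : ∀ x, H x = (deriv μ₀ r * vbar x.1 x.2.1 x.2.2 ^ 2 - x.2.2 / x.1 ^ 3) * f x) :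
    vbar r w L * TranspOp μ₀ lam0 f (r, w, L) = -Real.exp (μ₀ r - lam0 r) *
      (fderiv ℝ K (r, w, L) (1, 0, 0) + (-1) * fderiv ℝ H (r, w, L) (0, 1, 0) +
        (2 * deriv μ₀ r) * K (r, w, L)) := by
  have hv := vbar_pos w hr hL
  have hv0 := hv.ne'
  have hK' := ((hasDerivAt_slice_radius hf r w L).const_mul w).unique
      ((hasDerivAt_slice_radius hK r w L).congr_of_eventuallyEq
        (Filter.Eventually.of_forall fun s => (hKf (s, w, L)).symm))
  have hH' := (((((hasDerivAt_vbar_momentum w hr hL).pow 2).const_mul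
      (deriv μ₀ r)).sub_const (L / r ^ 3)).mul
    (hasDerivAt_slice_momentum hf r w L)).unique
      ((hasDerivAt_slice_momentum hH r w L).congr_of_eventuallyEq
        (Filter.Eventually.of_forall fun s => (hHf (r, s, L)).symm))
  rw [← hK', ← hH', transpOp_eq hf, hKf]
  simp only [Pi.pow_apply]
  field_simp
  push_cast
  ring

lemma momentumIntegral_momentum_mul_transpOp {f : ℝ × ℝ × ℝ → ℝ} (hf : ContDiff ℝ 1 f)
    (hsupp : HasCompactSupport f)
    (hsub : tsupport f ⊆ Ioi (0:ℝ) ×ˢ (univ : Set ℝ) ×ˢ Ioi (0:ℝ)) (μ₀ lam0 : ℝ → ℝ)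
    {K : ℝ × ℝ × ℝ → ℝ} (hKf : ∀ x, K x = x.2.1 ^ 2 / vbar x.1 x.2.1 x.2.2 * f x)
    (hK : ContDiff ℝ 1 K) (hKs : HasCompactSupport K) {r : ℝ} (hr : 0 < r) :
    momentumIntegral (fun x => x.2.1 * TranspOp μ₀ lam0 f x) r = -Real.exp (μ₀ r - lam0 r) *
      (momentumIntegral (fun x => fderiv ℝ K x (1, 0, 0)) r +
        deriv μ₀ r * momentumIntegral (fun x => vbar x.1 x.2.1 x.2.2 * f x) r +
        deriv μ₀ r * momentumIntegral K r -
        1 / r * momentumIntegral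
          (fun x => x.2.2 / (x.1 ^ 2 * vbar x.1 x.2.1 x.2.2) * f x) r) := by
  have hH := contDiff_weight_mul (k := fun x => x.2.1 * (deriv μ₀ r * vbar x.1 x.2.1 x.2.2 -
      x.2.2 / (x.1 ^ 3 * vbar x.1 x.2.1 x.2.2))) hf hsub fun s w L hs hL => by
    have hv := contDiffAt_vbar w hs hL
    have : s ^ 3 * vbar s w L ≠ 0 := (mul_pos (pow_pos hs 3) (vbar_pos w hs hL)).ne'
    fun_prop (disch := assumption)
  have hR := contDiff_weight_mul (k := fun x => vbar x.1 x.2.1 x.2.2) hf hsub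
    fun s w L hs hL => contDiffAt_vbar w hs hL
  have hQ := contDiff_weight_mul (k := fun x => x.2.2 / (x.1 ^ 2 * vbar x.1 x.2.1 x.2.2))
    hf hsub fun s w L hs hL => by
    have hv := contDiffAt_vbar w hs hL
    have : s ^ 2 * vbar s w L ≠ 0 := (mul_pos (pow_pos hs 2) (vbar_pos w hs hL)).ne'
    fun_prop (disch := assumption)
  have hHs := hsupp.mul_left (f := fun x : ℝ × ℝ × ℝ => x.2.1 *
    (deriv μ₀ r * vbar x.1 x.2.1 x.2.2 - x.2.2 / (x.1 ^ 3 * vbar x.1 x.2.1 x.2.2)))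
  have cR := And.intro hR.continuous
    (hsupp.mul_left (f := fun x : ℝ × ℝ × ℝ => vbar x.1 x.2.1 x.2.2))
  have cQ := And.intro hQ.continuous (hsupp.mul_left
    (f := fun x : ℝ × ℝ × ℝ => x.2.2 / (x.1 ^ 2 * vbar x.1 x.2.1 x.2.2)))
  have cK := And.intro hK.continuous hKs
  have c1 := And.intro (continuous_fderiv_apply_const hK (1, 0, 0)) (hKs.fderiv_apply ℝ (1, 0, 0))
  have c2 := And.intro (continuous_fderiv_apply_const hH (0, 1, 0)) (hHs.fderiv_apply ℝ (0, 1, 0))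
  have d1 := continuous_hasCompactSupport_add_const_mul c1 c2 (-1)
  have d2 := continuous_hasCompactSupport_add_const_mul d1 cR (deriv μ₀ r)
  have d3 := continuous_hasCompactSupport_add_const_mul d2 cK (deriv μ₀ r)
  refine (momentumIntegral_congr (h := fun x => -Real.exp (μ₀ r - lam0 r) *
    (fderiv ℝ K x (1, 0, 0) + (-1) * fderiv ℝ (fun x => x.2.1 * (deriv μ₀ r *
        vbar x.1 x.2.1 x.2.2 - x.2.2 / (x.1 ^ 3 * vbar x.1 x.2.1 x.2.2)) * f x) x (0, 1, 0) +
      deriv μ₀ r * (vbar x.1 x.2.1 x.2.2 * f x) + deriv μ₀ r * K x +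
      (-1 / r) * (x.2.2 / (x.1 ^ 2 * vbar x.1 x.2.1 x.2.2) * f x))) fun w L hL =>
    momentum_mul_transpOp hf μ₀ lam0 hK hH w hr hL hKf fun _ => rfl).trans ?_
  refine (momentumIntegral_const_mul _ _ r).trans ?_
  congr 1
  refine (momentumIntegral_add_const_mul d3 cQ (-1 / r) r).trans ?_
  rw [momentumIntegral_add_const_mul d2 cK, momentumIntegral_add_const_mul d1 cR,
    momentumIntegral_add_const_mul c1 c2, momentumIntegral_fderiv_momentum hH hHs]
  ring

lemma momentumIntegral_vbar_mul_transpOp {f : ℝ × ℝ × ℝ → ℝ} (hf : ContDiff ℝ 1 f)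
    (hsupp : HasCompactSupport f)
    (hsub : tsupport f ⊆ Ioi (0:ℝ) ×ˢ (univ : Set ℝ) ×ˢ Ioi (0:ℝ)) (μ₀ lam0 : ℝ → ℝ)
    {K : ℝ × ℝ × ℝ → ℝ} (hKf : ∀ x, K x = x.2.1 * f x)
    (hK : ContDiff ℝ 1 K) (hKs : HasCompactSupport K) {r : ℝ} (hr : 0 < r) :
    momentumIntegral (fun x => vbar x.1 x.2.1 x.2.2 * TranspOp μ₀ lam0 f x) r =
      -Real.exp (μ₀ r - lam0 r) *
        (momentumIntegral (fun x => fderiv ℝ K x (1, 0, 0)) r +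
          2 * deriv μ₀ r * momentumIntegral K r) := by
  have hH := contDiff_weight_mul
    (k := fun x => deriv μ₀ r * vbar x.1 x.2.1 x.2.2 ^ 2 - x.2.2 / x.1 ^ 3)
    hf hsub fun s w L hs hL => by
    have hv := contDiffAt_vbar w hs hL
    have : s ^ 3 ≠ 0 := (pow_pos hs 3).ne'
    fun_prop (disch := assumption)
  have hHs := hsupp.mul_left (f := fun x : ℝ × ℝ × ℝ =>
    deriv μ₀ r * vbar x.1 x.2.1 x.2.2 ^ 2 - x.2.2 / x.1 ^ 3)
  have cK := And.intro hK.continuous hKs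
  have c1 := And.intro (continuous_fderiv_apply_const hK (1, 0, 0)) (hKs.fderiv_apply ℝ (1, 0, 0))
  have c2 := And.intro (continuous_fderiv_apply_const hH (0, 1, 0)) (hHs.fderiv_apply ℝ (0, 1, 0))
  have d1 := continuous_hasCompactSupport_add_const_mul c1 c2 (-1)
  refine (momentumIntegral_congr (h := fun x => -Real.exp (μ₀ r - lam0 r) *
    (fderiv ℝ K x (1, 0, 0) + (-1) * fderiv ℝ (fun x => (deriv μ₀ r *
        vbar x.1 x.2.1 x.2.2 ^ 2 - x.2.2 / x.1 ^ 3) * f x) x (0, 1, 0) +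
      (2 * deriv μ₀ r) * K x)) fun w L hL =>
    vbar_mul_transpOp hf μ₀ lam0 hK hH w hr hL hKf fun _ => rfl).trans ?_
  refine (momentumIntegral_const_mul _ _ r).trans ?_
  rw [momentumIntegral_add_const_mul d1 cK,
    momentumIntegral_add_const_mul c1 c2, momentumIntegral_fderiv_momentum hH hHs]
  ring

lemma hasDerivAt_normalized_momentumIntegral {g : ℝ × ℝ × ℝ → ℝ} (hg : ContDiff ℝ 1 g)
    (hs : HasCompactSupport g) {r : ℝ} (hr : 0 < r) :
    HasDerivAt (fun s => π / s ^ 2 * momentumIntegral g s)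
      (π / r ^ 2 * momentumIntegral (fun x => fderiv ℝ g x (1, 0, 0)) r -
        2 / r * (π / r ^ 2 * momentumIntegral g r)) r := by
  have h := ((hasDerivAt_const r π).div (hasDerivAt_pow 2 r) (by positivity)).mul
    (hasDerivAt_momentumIntegral hg hs r)
  refine h.congr_deriv ?_
  simp only [Pi.div_apply]
  field_simp
  push_cast
  ring

theorem stmt_9 (μ₀ lam0 : ℝ → ℝ)
    (hμ : ContDiffOn ℝ 1 μ₀ (Ioi 0)) (hlam : ContDiffOn ℝ 1 lam0 (Ioi 0))
    (f : ℝ × ℝ × ℝ → ℝ) (hf : ContDiff ℝ 1 f) (hsupp : HasCompactSupport f)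
    (hsub : tsupport f ⊆ Ioi (0:ℝ) ×ˢ (univ : Set ℝ) ×ˢ Ioi (0:ℝ)) :
    ∀ r : ℝ, 0 < r →
      HasDerivAt (pF f)
        (-(deriv μ₀ r) * (pF f r + rhoF f r) - (2 / r) * (pF f r - qF f r) -
          Real.exp (lam0 r - μ₀ r) * jF (TranspOp μ₀ lam0 f) r) r ∧
      HasDerivAt (jF f)
        (-2 * (deriv μ₀ r + 1 / r) * jF f r -
          Real.exp (lam0 r - μ₀ r) * rhoF (TranspOp μ₀ lam0 f) r) r := by
  intro r hr
  have hexp : Real.exp (lam0 r - μ₀ r) * Real.exp (μ₀ r - lam0 r) = 1 := by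
    rw [← Real.exp_add]
    simp
  have hcancel (a b : ℝ) :
      Real.exp (lam0 r - μ₀ r) * (a * (-Real.exp (μ₀ r - lam0 r) * b)) = -(a * b) := by
    linear_combination (-(a * b)) * hexp
  constructor
  · have hK := contDiff_weight_mul (k := fun x => x.2.1 ^ 2 / vbar x.1 x.2.1 x.2.2) hf hsub
      fun s w L hs hL => by
        have hv := contDiffAt_vbar w hs hL
        have : vbar s w L ≠ 0 := (vbar_pos w hs hL).ne'
        fun_prop (disch := assumption)
    have hKs := hsupp.mul_left (f := fun x : ℝ × ℝ × ℝ => x.2.1 ^ 2 / vbar x.1 x.2.1 x.2.2)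
    have hT := momentumIntegral_momentum_mul_transpOp hf hsupp hsub μ₀ lam0 (fun _ => rfl)
      hK hKs hr
    refine (hasDerivAt_normalized_momentumIntegral hK hKs hr).congr_deriv ?_
    have hp : pF f r = π / r ^ 2 * momentumIntegral
      (fun x => x.2.1 ^ 2 / vbar x.1 x.2.1 x.2.2 * f x) r := rfl
    have hρ : rhoF f r = π / r ^ 2 * momentumIntegral
      (fun x => vbar x.1 x.2.1 x.2.2 * f x) r := rfl
    have hq : qF f r = π / (2 * r ^ 2) * momentumIntegral
      (fun x => x.2.2 / (x.1 ^ 2 * vbar x.1 x.2.1 x.2.2) * f x) r := rfl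
    have hj : jF (TranspOp μ₀ lam0 f) r = π / r ^ 2 * momentumIntegral
      (fun x => x.2.1 * TranspOp μ₀ lam0 f x) r := rfl
    rw [hp, hρ, hq, hj, hT, hcancel]
    ring
  · have hK := contDiff_weight_mul (k := fun x => x.2.1) hf hsub fun s w L _ _ => by fun_prop
    have hKs := hsupp.mul_left (f := fun x : ℝ × ℝ × ℝ => x.2.1)
    have hT := momentumIntegral_vbar_mul_transpOp hf hsupp hsub μ₀ lam0 (fun _ => rfl) hK hKs hr
    refine (hasDerivAt_normalized_momentumIntegral hK hKs hr).congr_deriv ?_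
    have hj : jF f r = π / r ^ 2 * momentumIntegral (fun x => x.2.1 * f x) r := rfl
    have hρ : rhoF (TranspOp μ₀ lam0 f) r = π / r ^ 2 * momentumIntegral
      (fun x => vbar x.1 x.2.1 x.2.2 * TranspOp μ₀ lam0 f x) r := rfl
    rw [hj, hρ, hT, hcancel]
    ring

end
end

section
/- Let H be a real Hilbert space, D ⊆ H a subspace, and B : D → H a linear map such that ⟨Bf, g⟩ = −⟨f, Bg⟩ for all f, g ∈ D, such that ker(B) is a complete (closed) subspace of H, and such that range(B) = ker(B)^⊥. Let D₂ := {f ∈ D : Bf ∈ D} and let B² denote the composition B∘B defined on D₂. Then ker(B²) = ker(B) and range(B²) = range(B). -/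
open scoped RealInnerProductSpace

theorem stmt_14 {H : Type*} [NormedAddCommGroup H] [InnerProductSpace ℝ H]
    (D : Submodule ℝ H) (B : D →ₗ[ℝ] H)
    (hskew : ∀ f g : D, ⟪B f, (g : H)⟫ = -⟪(f : H), B g⟫)
    (hker : IsComplete (((LinearMap.ker B).map D.subtype : Submodule ℝ H) : Set H))
    (hrange : LinearMap.range B = ((LinearMap.ker B).map D.subtype)ᗮ) :
    {x : H | ∃ hx : x ∈ D, ∃ hBx : B ⟨x, hx⟩ ∈ D, B ⟨B ⟨x, hx⟩, hBx⟩ = 0} =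
      {x : H | ∃ hx : x ∈ D, B ⟨x, hx⟩ = 0} ∧
    {y : H | ∃ x : H, ∃ hx : x ∈ D, ∃ hBx : B ⟨x, hx⟩ ∈ D, B ⟨B ⟨x, hx⟩, hBx⟩ = y} =
      {y : H | ∃ x : H, ∃ hx : x ∈ D, B ⟨x, hx⟩ = y} := by
  have mem_ker : ∀ f : D, B f = 0 → (f : H) ∈ (LinearMap.ker B).map D.subtype :=
    fun f hf => ⟨f, hf, rfl⟩
  refine ⟨Set.ext fun x => ⟨?_, ?_⟩, Set.ext fun y => ⟨?_, ?_⟩⟩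
  · rintro ⟨hx, hBx, h⟩
    have hperp : B ⟨x, hx⟩ ∈ ((LinearMap.ker B).map D.subtype)ᗮ :=
      hrange ▸ LinearMap.mem_range_self B ⟨x, hx⟩
    exact ⟨hx, inner_self_eq_zero.mp (hperp _ (mem_ker ⟨_, hBx⟩ h))⟩
  · rintro ⟨hx, h⟩
    have hBx : B ⟨x, hx⟩ ∈ D := h ▸ D.zero_mem
    have hzero : (⟨B ⟨x, hx⟩, hBx⟩ : D) = 0 := Subtype.ext h
    exact ⟨hx, hBx, by rw [hzero, map_zero]⟩
  · rintro ⟨x, hx, hBx, h⟩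
    exact ⟨_, hBx, h⟩
  · rintro ⟨x, hx, rfl⟩
    have : CompleteSpace ((LinearMap.ker B).map D.subtype) :=
      completeSpace_coe_iff_isComplete.mpr hker
    obtain ⟨_, ⟨k, hk, rfl⟩, r, hr, hxr⟩ :=
      ((LinearMap.ker B).map D.subtype).exists_add_mem_mem_orthogonal x
    rw [← hrange] at hr
    obtain ⟨z, rfl⟩ := hr
    have hBz : B z = ((⟨x, hx⟩ - k : D) : H) := by simp [hxr]
    have hBzD : B z ∈ D := hBz ▸ Subtype.property _
    have hsub : (⟨B z, hBzD⟩ : D) = ⟨x, hx⟩ - k := Subtype.ext hBz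
    have hk0 : B k = 0 := hk
    exact ⟨z, z.2, hBzD, by rw [hsub, map_sub, hk0, sub_zero]⟩
end

section
/- For every γ > 0 the following hold. (a) If f ∈ V ∩ 𝓗, f ≠ 0 and L_γ f = 0, then g := S f satisfies g ≠ 0 and Q g = γ g. (b) If g ∈ 𝓗, g ≠ 0 and Q g = γ g, then f := −J(S g) lies in V ∩ 𝓗, f ≠ 0, and L_γ f = 0. (c) The map f ↦ S f is a linear bijection from {f ∈ V ∩ 𝓗 : L_γ f = 0} onto {g ∈ 𝓗 : Q g = γ g}, with inverse g ↦ −(1/γ)·J(S g); in particular these two spaces have the same dimension. -/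
open Set

/-- A linear bijection between two sets whose inverse is the restriction of a linear map preserves
the rank of the linear span. -/
theorem rank_span_eq_of_bijOn_of_leftInvOn {R M : Type*} [Ring R] [AddCommGroup M] [Module R M]
    {φ ψ : M →ₗ[R] M} {s t : Set M} (hφ : BijOn φ s t) (hψ : LeftInvOn ψ φ s) :
    Module.rank R (Submodule.span R s) = Module.rank R (Submodule.span R t) := by
  have hst : (Submodule.span R s).map φ = Submodule.span R t := by
    rw [Submodule.map_span, hφ.image_eq]
  have hts : (Submodule.span R t).map ψ = Submodule.span R s := by
    rw [Submodule.map_span, ← hφ.image_eq, hψ.image_image]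
  exact le_antisymm (hts ▸ rank_map_le ψ _) (hst ▸ rank_map_le φ _)

/-- If `J` inverts `B` on the subspace `W`, the kernel equation `-B f - γ⁻¹ S² f = 0` is equivalent
to the fixed-point equation `J S² f = -γ f`. -/
theorem neg_sub_smul_eq_zero_iff {H : Type*} [AddCommGroup H] [Module ℝ H]
    {W V : Submodule ℝ H} {B : V →ₗ[ℝ] H} {S J : H →ₗ[ℝ] H}
    (hS : ∀ h, S h ∈ W) (hJV : ∀ h ∈ W, J h ∈ V)
    (hBJ : ∀ h, h ∈ W → ∀ hv : J h ∈ V, B ⟨J h, hv⟩ = h)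
    (hJB : ∀ f, ∀ hv : f ∈ V, f ∈ W → J (B ⟨f, hv⟩) = f)
    {γ : ℝ} (hγ : γ ≠ 0) {f : H} (hv : f ∈ V) (hf : f ∈ W) :
    -B ⟨f, hv⟩ - (1 / γ) • S (S f) = 0 ↔ J (S (S f)) = -γ • f := by
  constructor
  · intro h
    have hSS : S (S f) = -γ • B ⟨f, hv⟩ := by
      have h' : (1 / γ) • S (S f) = -B ⟨f, hv⟩ := (sub_eq_zero.mp h).symm
      rw [neg_smul, ← smul_neg, ← h', smul_smul, mul_one_div_cancel hγ, one_smul]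
    rw [hSS, map_smul, hJB f hv hf]
  · intro h
    have hB : B ⟨J (S (S f)), hJV _ (hS _)⟩ = -γ • B ⟨f, hv⟩ := by
      rw [← map_smul]
      exact congrArg B (Subtype.ext h)
    rw [← hBJ _ (hS _) (hJV _ (hS _)), hB, smul_smul, mul_neg, one_div_mul_cancel hγ, neg_smul,
      one_smul, sub_self]

theorem stmt_18 {H : Type*} [NormedAddCommGroup H] [InnerProductSpace ℝ H]
    (Hodd V : Submodule ℝ H) (B₂ : V →ₗ[ℝ] H) (S J : H →L[ℝ] H)
    (hS : ∀ h : H, S h ∈ Hodd)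
    (hJV : ∀ h ∈ Hodd, J h ∈ V) (hJH : ∀ h ∈ Hodd, J h ∈ Hodd)
    (hBJ : ∀ h : H, h ∈ Hodd → ∀ hv : J h ∈ V, B₂ ⟨J h, hv⟩ = h)
    (hJB : ∀ f : H, ∀ hv : f ∈ V, f ∈ Hodd → J (B₂ ⟨f, hv⟩) = f)
    (γ : ℝ) (hγ : 0 < γ) :
    (∀ f : H, ∀ hv : f ∈ V, f ∈ Hodd → f ≠ 0 →
      -B₂ ⟨f, hv⟩ - (1 / γ) • S (S f) = 0 →
      S f ≠ 0 ∧ -S (J (S (S f))) = γ • S f) ∧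
    (∀ g : H, g ∈ Hodd → g ≠ 0 → -S (J (S g)) = γ • g →
      -J (S g) ∈ V ∧ -J (S g) ∈ Hodd ∧ -J (S g) ≠ 0 ∧
      ∀ hv : -J (S g) ∈ V,
        -B₂ ⟨-J (S g), hv⟩ - (1 / γ) • S (S (-J (S g))) = 0) ∧
    (Set.BijOn (⇑S)
        {f : H | ∃ hv : f ∈ V, f ∈ Hodd ∧ -B₂ ⟨f, hv⟩ - (1 / γ) • S (S f) = 0}
        {g : H | g ∈ Hodd ∧ -S (J (S g)) = γ • g} ∧
      Set.InvOn (fun g => -(1 / γ) • J (S g)) (⇑S)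
        {f : H | ∃ hv : f ∈ V, f ∈ Hodd ∧ -B₂ ⟨f, hv⟩ - (1 / γ) • S (S f) = 0}
        {g : H | g ∈ Hodd ∧ -S (J (S g)) = γ • g} ∧
      Module.rank ℝ
          ↥(Submodule.span ℝ
            {f : H | ∃ hv : f ∈ V, f ∈ Hodd ∧ -B₂ ⟨f, hv⟩ - (1 / γ) • S (S f) = 0}) =
        Module.rank ℝ
          ↥(Submodule.span ℝ {g : H | g ∈ Hodd ∧ -S (J (S g)) = γ • g})) := by
  have hγ0 : γ ≠ 0 := hγ.ne'
  have hker {f : H} (hv : f ∈ V) (hf : f ∈ Hodd) :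
      -B₂ ⟨f, hv⟩ - (1 / γ) • S (S f) = 0 ↔ J (S (S f)) = -γ • f :=
    neg_sub_smul_eq_zero_iff (S := S.toLinearMap) (J := J.toLinearMap) hS hJV hBJ hJB hγ0 hv hf
  have hQ {f : H} (h : J (S (S f)) = -γ • f) : -S (J (S (S f))) = γ • S f := by
    rw [h, map_smul, neg_smul, neg_neg]
  have hJS {g : H} (h : -S (J (S g)) = γ • g) (c : ℝ) :
      J (S (S (c • J (S g)))) = -γ • c • J (S g) := by
    rw [map_smul, neg_eq_iff_eq_neg.mp h]
    simp only [map_smul, map_neg, smul_neg, neg_smul, smul_comm c γ]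
  have hleft : LeftInvOn (fun g => -(1 / γ) • J (S g)) S
      {f : H | ∃ hv : f ∈ V, f ∈ Hodd ∧ -B₂ ⟨f, hv⟩ - (1 / γ) • S (S f) = 0} := by
    rintro f ⟨hv, hf, h⟩
    simp only [(hker hv hf).mp h, smul_smul, neg_mul_neg, one_div_mul_cancel hγ0, one_smul]
  have hright : RightInvOn (fun g => -(1 / γ) • J (S g)) S
      {g : H | g ∈ Hodd ∧ -S (J (S g)) = γ • g} := by
    rintro g ⟨-, h⟩
    simp only [map_smul, neg_eq_iff_eq_neg.mp h, neg_smul_neg, smul_smul, one_div_mul_cancel hγ0,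
      one_smul]
  have hbij : BijOn S
      {f : H | ∃ hv : f ∈ V, f ∈ Hodd ∧ -B₂ ⟨f, hv⟩ - (1 / γ) • S (S f) = 0}
      {g : H | g ∈ Hodd ∧ -S (J (S g)) = γ • g} := by
    refine InvOn.bijOn ⟨hleft, hright⟩ ?_ ?_
    · rintro f ⟨hv, hf, h⟩
      exact ⟨hS f, hQ ((hker hv hf).mp h)⟩
    · rintro g ⟨-, h⟩
      have hv := V.smul_mem (-(1 / γ)) (hJV _ (hS g))
      have hf := Hodd.smul_mem (-(1 / γ)) (hJH _ (hS g))
      exact ⟨hv, hf, (hker hv hf).mpr (hJS h _)⟩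
  refine ⟨fun f hv hf hf0 h => ?_, fun g _ hg0 h => ?_, hbij, ⟨hleft, hright⟩, ?_⟩
  · have hJf := (hker hv hf).mp h
    refine ⟨fun h0 => hf0 ?_, hQ hJf⟩
    rw [h0, map_zero, map_zero] at hJf
    exact (smul_eq_zero.mp hJf.symm).resolve_left (neg_ne_zero.mpr hγ0)
  · have hf := Hodd.neg_mem (hJH _ (hS g))
    refine ⟨V.neg_mem (hJV _ (hS g)), hf, fun h0 => ?_, fun hv => (hker hv hf).mpr ?_⟩
    · rw [← map_neg, h0, map_zero] at h
      exact (smul_ne_zero hγ0 hg0) h.symm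
    · simpa only [neg_one_smul] using hJS h (-1)
  · exact rank_span_eq_of_bijOn_of_leftInvOn (φ := S.toLinearMap)
      (ψ := -(1 / γ) • J.toLinearMap ∘ₗ S.toLinearMap) hbij hleft
end
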